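/- Let s : ℝ → ℝ be continuously differentiable, let u : ℝ × ℝ → ℝ be continuously differentiable with ∂_t u and ∂_x u jointly continuous, suppose there is a compact set K ⊆ ℝ such that u(t,x) = 0 for all t and all x ∉ K, and suppose ∂_t u(t,x) + s(x)·u(t,x)·∂_x u(t,x) = 0 for all (t,x). Then for every t, the function τ ↦ ½ ∫_ℝ u(τ,x)² dx is differentiable at t with derivative (1/3) ∫_ℝ s′(x)·u(t,x)³ dx. -/

import Mathlib

open MeasureTheory Set Topology in
/-- Differentiation under the integral sign for a jointly continuous derivative supported in a
fixed compact set. -/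
theorem hasDerivAt_integral_of_continuous_of_compact_support {F F' : ℝ → ℝ → ℝ}
    (hF : ∀ t, Continuous (F t)) (hF' : Continuous fun p : ℝ × ℝ => F' p.1 p.2)
    (hderiv : ∀ t x, HasDerivAt (fun τ => F τ x) (F' t x) t)
    {K : Set ℝ} (hK : IsCompact K) (hsupp : ∀ t x, x ∉ K → F t x = 0)
    (hsupp' : ∀ t x, x ∉ K → F' t x = 0) (t : ℝ) :
    HasDerivAt (fun τ => ∫ x, F τ x) (∫ x, F' t x) t := by
  obtain ⟨C, hC⟩ := ((isCompact_Icc (a := t - 1) (b := t + 1)).prod hK).exists_bound_of_continuousOn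
    hF'.continuousOn
  refine (hasDerivAt_integral_of_dominated_loc_of_deriv_le
    (s := Icc (t - 1) (t + 1)) (bound := K.indicator fun _ => C)
    (Icc_mem_nhds (by linarith) (by linarith))
    (.of_forall fun τ => (hF τ).aestronglyMeasurable)
    ((hF t).integrable_of_hasCompactSupport (.intro hK (hsupp t)))
    (by fun_prop) (.of_forall fun x τ hτ => ?_) ?_
    (.of_forall fun x τ _ => hderiv τ x)).2
  · by_cases hx : x ∈ K
    · simpa [hx] using hC (τ, x) ⟨hτ, hx⟩
    · simp [hx, hsupp' τ x hx]
  · rw [integrable_indicator_iff hK.measurableSet]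
    exact integrableOn_const hK.measure_lt_top.ne

open MeasureTheory in
/-- Integration by parts of `s` against the derivative of the cube of a compactly supported `v`. -/
theorem integral_deriv_mul_pow_three_eq_neg {s v v' : ℝ → ℝ} (hs : ContDiff ℝ 1 s)
    (hv : ∀ x, HasDerivAt v (v' x) x) (hv' : Continuous v')
    {K : Set ℝ} (hK : IsCompact K) (hsupp : ∀ x, x ∉ K → v x = 0) :
    ∫ x, deriv s x * v x ^ 3 = -∫ x, s x * (3 * v x ^ 2 * v' x) := by
  have hvc : Continuous v := continuous_iff_continuousAt.2 fun x => (hv x).continuousAt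
  have hsc := hs.continuous
  have hds : Continuous (deriv s) := hs.continuous_deriv le_rfl
  rw [integral_mul_deriv_eq_deriv_mul_of_integrable (u := s) (u' := deriv s)
    (v := fun x => v x ^ 3) (v' := fun x => 3 * v x ^ 2 * v' x), neg_neg]
  · exact fun x _ => (hs.differentiable one_ne_zero x).hasDerivAt
  · exact fun x _ => by simpa using (hv x).fun_pow 3
  all_goals
    refine Continuous.integrable_of_hasCompactSupport (by fun_prop) (.intro hK fun x hx => ?_)
    simp [hsupp x hx]

/-- Energy balance for Burgers' equation with a slowing-down function:
if `∂ₜu + s(x) u ∂ₓu = 0` with `u` compactly supported in space, then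
`d/dt (½ ∫ u² dx) = (1/3) ∫ s'(x) u³ dx`. -/
theorem stmt_14 (s : ℝ → ℝ) (hs : ContDiff ℝ 1 s)
    (u ut ux : ℝ → ℝ → ℝ)
    (huC1 : ContDiff ℝ 1 (fun p : ℝ × ℝ => u p.1 p.2))
    (hut : ∀ t x : ℝ, HasDerivAt (fun τ => u τ x) (ut t x) t)
    (hux : ∀ t x : ℝ, HasDerivAt (fun y => u t y) (ux t x) x)
    (hutc : Continuous fun p : ℝ × ℝ => ut p.1 p.2)
    (huxc : Continuous fun p : ℝ × ℝ => ux p.1 p.2)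
    (K : Set ℝ) (hK : IsCompact K) (husupp : ∀ t x : ℝ, x ∉ K → u t x = 0)
    (hPDE : ∀ t x : ℝ, ut t x + s x * u t x * ux t x = 0) :
    ∀ t : ℝ, HasDerivAt (fun τ : ℝ => (1 / 2) * ∫ x : ℝ, (u τ x) ^ 2)
      ((1 / 3) * ∫ x : ℝ, deriv s x * (u t x) ^ 3) t := by
  intro t
  have huc := huC1.continuous
  have hcont : ∀ τ, Continuous (u τ) := fun τ => huc.comp (Continuous.prodMk_right τ)
  have henergy := (hasDerivAt_integral_of_continuous_of_compact_support
    (F := fun τ x => u τ x ^ 2) (F' := fun τ x => 2 * u τ x * ut τ x)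
    (fun τ => (hcont τ).pow 2) (by fun_prop) (fun τ x => by simpa using (hut τ x).fun_pow 2) hK
    (fun τ x hx => by simp [husupp τ x hx]) (fun τ x hx => by simp [husupp τ x hx]) t).const_mul
    (1 / 2 : ℝ)
  refine henergy.congr_deriv (Eq.symm ?_)
  rw [integral_deriv_mul_pow_three_eq_neg hs (hux t)
    (huxc.comp (Continuous.prodMk_right t)) hK (husupp t), ← MeasureTheory.integral_neg,
    ← MeasureTheory.integral_const_mul, ← MeasureTheory.integral_const_mul]
  congr 1 with x
  linear_combination (-u t x) * hPDE t x
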